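/- The constructed arrears instance I′ has a feasible solution if and only if the 1-IN-3SAT instance is a yes-instance, i.e., there exists a truth assignment of x_1,…,x_n under which every clause c_j has exactly one true literal. Moreover, from a feasible solution of I′ a satisfying assignment is obtained by setting x_i true if and only if X ∩ Y_i = T_i. -/

import Mathlib

/-! Construction of the arrears instance `I′` from a 1-IN-3SAT instance with `n`
variables and `m` clauses, where clause `j` has literals `c j 0, c j 1, c j 2`, a literal
being a pair `(i, pos)` meaning `xᵢ` if `pos = true` and `¬xᵢ` if `pos = false`. -/

/-- The base `B = 100 n² m²`. -/
def Bval (n m : ℕ) : ℕ := 100 * n ^ 2 * m ^ 2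

/-- `N = 3m(m+2) + 1`. -/
def Nval (m : ℕ) : ℕ := 3 * m * (m + 2) + 1

/-- The items: `Sum.inl (i, j, k, pos)` is `u_{i,j,k}` (if `pos = true`) or `ū_{i,j,k}`
(if `pos = false`); `Sum.inr (i, l, pos)` is `w_{i,l}` or `w̄_{i,l}`. -/
abbrev Item (n m : ℕ) :=
  (Fin n × Fin m × Fin 3 × Bool) ⊕ (Fin n × Fin (3 * m * (m + 1) + 1) × Bool)

/-- The variable index of an item. -/
def itemVar {n m : ℕ} : Item n m → Fin n
  | Sum.inl (i, _, _, _) => i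
  | Sum.inr (i, _, _) => i

/-- The polarity of an item (`true` for the `u`/`w` items, `false` for `ū`/`w̄`). -/
def itemPos {n m : ℕ} : Item n m → Bool
  | Sum.inl (_, _, _, pos) => pos
  | Sum.inr (_, _, pos) => pos

/-- First payment amount of `u_{i,j,k}`. -/
def pu (n m : ℕ) (c : Fin m → Fin 3 → Fin n × Bool) (i : Fin n) (j : Fin m) (k : Fin 3) : ℕ :=
  (Bval n m ^ 2 + ((i : ℕ) + 1)) * (Bval n m + 1) * Bval n m +
    (if c j k = (i, true) then (j : ℕ) + 2 else 0)

/-- First payment amount of `ū_{i,j,k}`. -/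
def pub (n m : ℕ) (c : Fin m → Fin 3 → Fin n × Bool) (i : Fin n) (j : Fin m) (k : Fin 3) : ℕ :=
  (Bval n m ^ 2 + ((i : ℕ) + 1)) * Bval n m ^ 2 +
    (if c j k = (i, false) then (j : ℕ) + 2 else 0)

/-- `K_i = Σ_{u ∈ U_i} (p_{u,1} mod B)`. -/
def Kv (n m : ℕ) (c : Fin m → Fin 3 → Fin n × Bool) (i : Fin n) : ℕ :=
  ∑ j : Fin m, ∑ k : Fin 3, pu n m c i j k % Bval n m

/-- `K̄_i = Σ_{u ∈ Ū_i} (p_{u,1} mod B)`. -/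
def Kbv (n m : ℕ) (c : Fin m → Fin 3 → Fin n × Bool) (i : Fin n) : ℕ :=
  ∑ j : Fin m, ∑ k : Fin 3, pub n m c i j k % Bval n m

/-- The first payment amount `p_{y,1}` of each item `y` (the second amount is `2 p_{y,1}`). -/
def p1 (n m : ℕ) (c : Fin m → Fin 3 → Fin n × Bool) : Item n m → ℕ
  | Sum.inl (i, j, k, pos) => if pos then pu n m c i j k else pub n m c i j k
  | Sum.inr (i, l, pos) =>
      if pos then
        if (l : ℕ) + 1 ≤ 3 * m * (m + 1) - Kv n m c i then
          (Bval n m ^ 2 + ((i : ℕ) + 1)) * (Bval n m + 1) * Bval n m + 1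
        else (Bval n m ^ 2 + ((i : ℕ) + 1)) * (Bval n m + 1) * Bval n m
      else
        if (l : ℕ) + 1 ≤ 3 * m * (m + 1) - Kbv n m c i then
          (Bval n m ^ 2 + ((i : ℕ) + 1)) * Bval n m ^ 2 + 1
        else if (l : ℕ) + 1 ≤ 3 * m * (m + 1) then
          (Bval n m ^ 2 + ((i : ℕ) + 1)) * Bval n m ^ 2
        else (Bval n m ^ 2 + ((i : ℕ) + 1)) * (Bval n m + Nval m) * Bval n m

/-- The first payment date `a_{y,1}`: day `i` for the items of variable `xᵢ`. -/
def a1 {n m : ℕ} (y : Item n m) : ℕ := (itemVar y : ℕ) + 1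

/-- The second payment date `a_{y,2}`. -/
def a2 (n m : ℕ) (c : Fin m → Fin 3 → Fin n × Bool) : Item n m → ℕ
  | Sum.inl (i, j, k, pos) => if c j k = (i, pos) then n + 2 + ((j : ℕ) + 1) else n + 1
  | Sum.inr (i, l, pos) =>
      if pos then
        if (l : ℕ) + 1 ≤ 3 * m * (m + 1) - Kv n m c i then n + 2 else n + 1
      else
        if (l : ℕ) + 1 ≤ 3 * m * (m + 1) - Kbv n m c i then n + 2 else n + 1

/-- `R = N(B+1)(nB² + n(n+1)/2)B + 3m(m+1)n`. -/
def Rval (n m : ℕ) : ℕ :=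
  Nval m * (Bval n m + 1) * (n * Bval n m ^ 2 + n * (n + 1) / 2) * Bval n m +
    3 * m * (m + 1) * n

/-- The budget amount `q_i` of the budget constraint on day `i`, for `1 ≤ i ≤ n+m+2`. -/
def qv (n m : ℕ) (i : ℕ) : ℕ :=
  if i < n then Nval m * (Bval n m + 1) * i * Bval n m ^ 3 + (Bval n m ^ 3 - 1)
  else if i = n then Rval n m
  else if i = n + 1 then
    (Nval m * n + 6 * m * n + 2 * n + m * (m + 1)) * Bval n m ^ 4 + (Bval n m ^ 4 - 1)
  else if i ≤ n + m + 1 then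
    (3 * Nval m * n - 2 * (n + m + 2 - i)) * Bval n m ^ 4 + (Bval n m ^ 4 - 1)
  else 3 * Rval n m

/-- A solution of the arrears instance chooses for every item `y` one of its two options
(`z y = true` means the second option `(a_{y,2}, 2 p_{y,1})` is chosen); it is feasible if
every budget constraint is satisfied. -/
def Feasible (n m : ℕ) (c : Fin m → Fin 3 → Fin n × Bool) (z : Item n m → Bool) : Prop :=
  ∀ i : ℕ, 1 ≤ i → i ≤ n + m + 2 →
    (∑ y : Item n m,
      if (if z y then a2 n m c y else a1 y) ≤ i then
        (if z y then 2 * p1 n m c y else p1 n m c y) else 0) ≤ qv n m i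

/-- `X`: the set of items for which the second option is chosen. -/
def Xset (n m : ℕ) (z : Item n m → Bool) : Finset (Item n m) :=
  Finset.univ.filter fun y => z y = true

/-- `T_i = U_i ∪ W_i`: the positive items of variable `xᵢ`. -/
def Tset (n m : ℕ) (i : Fin n) : Finset (Item n m) :=
  Finset.univ.filter fun y => itemVar y = i ∧ itemPos y = true

/-- `T̄_i = Ū_i ∪ W̄_i`: the negative items of variable `xᵢ`. -/
def Tbar (n m : ℕ) (i : Fin n) : Finset (Item n m) :=
  Finset.univ.filter fun y => itemVar y = i ∧ itemPos y = false

/-- `Y_i = T_i ∪ T̄_i`: all items of variable `xᵢ`. -/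
def Yset (n m : ℕ) (i : Fin n) : Finset (Item n m) :=
  Finset.univ.filter fun y => itemVar y = i

/-- `Z_j`: the items whose second payment date is `n + 1 + j`. -/
def Zset (n m : ℕ) (c : Fin m → Fin 3 → Fin n × Bool) (j : ℕ) : Finset (Item n m) :=
  Finset.univ.filter fun y => a2 n m c y = n + 1 + j

open Finset

/-- Coefficient of `B³` in the first amount. -/
def ee {n m : ℕ} : Item n m → ℕ
  | Sum.inl (_, _, _, pos) => if pos then 1 else 0
  | Sum.inr (_, l, pos) =>
      if pos then 1 else if (l : ℕ) + 1 ≤ 3 * m * (m + 1) then 0 else Nval m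

/-- Lowest digit of the first amount. -/
def ss {n m : ℕ} (c : Fin m → Fin 3 → Fin n × Bool) : Item n m → ℕ
  | Sum.inl (i, j, k, pos) => if c j k = (i, pos) then (j : ℕ) + 2 else 0
  | Sum.inr (i, l, pos) =>
      if (l : ℕ) + 1 ≤ 3 * m * (m + 1) - (if pos then Kv n m c i else Kbv n m c i) then 1 else 0

lemma Nval_le (m : ℕ) (hm : 0 < m) : Nval m ≤ 10 * m ^ 2 := by
  unfold Nval; nlinarith

lemma Bbound (n m : ℕ) (hn : 0 < n) (hm : 0 < m) : 8 * (Nval m * n ^ 2) < Bval n m := by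
  have h := Nval_le m hm
  have h2 : 0 < n ^ 2 * m ^ 2 := by positivity
  have : Nval m * n ^ 2 ≤ 10 * m ^ 2 * n ^ 2 := Nat.mul_le_mul_right _ h
  unfold Bval
  nlinarith

lemma B_gt (n m : ℕ) (hn : 0 < n) (hm : 0 < m) : m + 2 < Bval n m := by
  have := Bbound n m hn hm
  have h1 : 1 ≤ n ^ 2 := Nat.one_le_pow _ _ hn
  have h2 : m + 2 ≤ 8 * Nval m := by unfold Nval; nlinarith
  nlinarith

lemma a2_eq {n m : ℕ} (c : Fin m → Fin 3 → Fin n × Bool) (y : Item n m) :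
    a2 n m c y = n + 1 + ss c y := by
  rcases y with ⟨i, j, k, pos⟩ | ⟨i, l, pos⟩
  · simp only [a2, ss]; split_ifs <;> omega
  · cases pos <;> simp only [a2, ss] <;> simp <;> split_ifs <;> omega

lemma ss_le {n m : ℕ} (c : Fin m → Fin 3 → Fin n × Bool) (y : Item n m) : ss c y ≤ m + 1 := by
  rcases y with ⟨i, j, k, pos⟩ | ⟨i, l, pos⟩
  · simp only [ss]; have := j.2; split_ifs <;> omega
  · simp only [ss]; split_ifs <;> omega

/-- digit expansion -/
lemma p1_eq {n m : ℕ} (c : Fin m → Fin 3 → Fin n × Bool) (y : Item n m) :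
    p1 n m c y = Bval n m ^ 4 * 1 + Bval n m ^ 3 * ee y + Bval n m ^ 2 * ((itemVar y : ℕ) + 1)
      + Bval n m * (((itemVar y : ℕ) + 1) * ee y) + ss c y := by
  rcases y with ⟨i, j, k, pos⟩ | ⟨i, l, pos⟩
  · cases pos <;> simp [p1, ss, ee, itemVar, pu, pub] <;> ring
  · cases pos <;> simp only [p1, ss, ee, itemVar] <;> simp
    · split_ifs <;> first | (exfalso; omega) | ring
    · split_ifs <;> ring

lemma p1_sum {n m : ℕ} (c : Fin m → Fin 3 → Fin n × Bool) (S : Finset (Item n m)) :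
    ∑ y ∈ S, p1 n m c y = Bval n m ^ 4 * (∑ y ∈ S, 1) + Bval n m ^ 3 * (∑ y ∈ S, ee y)
      + Bval n m ^ 2 * (∑ y ∈ S, ((itemVar y : ℕ) + 1))
      + Bval n m * (∑ y ∈ S, ((itemVar y : ℕ) + 1) * ee y) + ∑ y ∈ S, ss c y := by
  simp only [p1_eq, mul_sum]
  rw [sum_add_distrib, sum_add_distrib, sum_add_distrib, sum_add_distrib]

/-- block of items -/
def blk (n m : ℕ) (i : Fin n) (b : Bool) : Finset (Item n m) :=
  univ.filter fun y => itemVar y = i ∧ itemPos y = b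

lemma blk_sum {n m : ℕ} (i : Fin n) (b : Bool) (f : Item n m → ℕ) :
    ∑ y ∈ blk n m i b, f y = (∑ j : Fin m, ∑ k : Fin 3, f (Sum.inl (i, j, k, b)))
      + ∑ l : Fin (3 * m * (m + 1) + 1), f (Sum.inr (i, l, b)) := by
  unfold blk
  rw [sum_filter, Fintype.sum_sum_type, Fintype.sum_prod_type, Fintype.sum_prod_type]
  congr 1
  · rw [sum_eq_single i]
    · simp only [Fintype.sum_prod_type, itemVar, itemPos]
      refine sum_congr rfl fun j _ => sum_congr rfl fun k _ => ?_
      cases b <;> simp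
    · intro i' _ h; simp [itemVar, h]
    · simp
  · rw [sum_eq_single i]
    · simp only [Fintype.sum_prod_type, itemVar, itemPos]
      refine sum_congr rfl fun j _ => ?_
      cases b <;> simp
    · intro i' _ h; simp [itemVar, h]
    · simp

lemma blk_one {n m : ℕ} (i : Fin n) (b : Bool) : ∑ _y ∈ blk n m i b, 1 = Nval m := by
  rw [blk_sum]; simp [Nval]; ring

lemma blk_ee {n m : ℕ} (i : Fin n) (b : Bool) : ∑ y ∈ blk n m i b, ee y = Nval m := by
  rw [blk_sum]
  cases b
  · simp only [ee, Fin.sum_univ_castSucc]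
    simp
  · simp [ee, Nval]; ring

lemma blk_ss {n m : ℕ} (hn : 0 < n) (hm : 0 < m) (c : Fin m → Fin 3 → Fin n × Bool)
    (i : Fin n) (b : Bool) : ∑ y ∈ blk n m i b, ss c y = 3 * m * (m + 1) := by
  rw [blk_sum]
  have hB := B_gt n m hn hm
  have key : (∑ j : Fin m, ∑ k : Fin 3, ss c (Sum.inl (i, j, k, b)))
      = if b then Kv n m c i else Kbv n m c i := by
    cases b
    · simp only [Kbv, ss]
      simp
      refine sum_congr rfl fun j _ => sum_congr rfl fun k _ => ?_
      have hj := j.2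
      have : pub n m c i j k = (if c j k = (i, false) then (j : ℕ) + 2 else 0)
        + Bval n m * ((Bval n m ^ 2 + ((i : ℕ) + 1)) * Bval n m) := by unfold pub; ring
      rw [this, Nat.add_mul_mod_self_left, Nat.mod_eq_of_lt]
      split_ifs <;> omega
    · simp only [Kv, ss]
      simp
      refine sum_congr rfl fun j _ => sum_congr rfl fun k _ => ?_
      have hj := j.2
      have : pu n m c i j k = (if c j k = (i, true) then (j : ℕ) + 2 else 0)
        + Bval n m * ((Bval n m ^ 2 + ((i : ℕ) + 1)) * (Bval n m + 1)) := by unfold pu; ring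
      rw [this, Nat.add_mul_mod_self_left, Nat.mod_eq_of_lt]
      split_ifs <;> omega
  have hle : (∑ j : Fin m, ∑ k : Fin 3, ss c (Sum.inl (i, j, k, b))) ≤ 3 * m * (m + 1) := by
    calc _ ≤ ∑ j : Fin m, ∑ k : Fin 3, (m + 1) :=
          sum_le_sum fun j _ => sum_le_sum fun k _ => ss_le c _
      _ = _ := by simp; ring
  rw [key] at hle ⊢
  simp only [ss]
  generalize (if b = true then Kv n m c i else Kbv n m c i) = K at hle ⊢
  have : ∑ l : Fin (3 * m * (m + 1) + 1), (if (l : ℕ) + 1 ≤ 3 * m * (m + 1) - K then 1 else 0)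
      = 3 * m * (m + 1) - K := by
    rw [Fin.sum_univ_eq_sum_range (fun l => if l + 1 ≤ 3 * m * (m + 1) - K then 1 else 0)]
    rw [← sum_filter, sum_const, smul_eq_mul, mul_one]
    have : filter (fun l => l + 1 ≤ 3 * m * (m + 1) - K) (range (3 * m * (m + 1) + 1))
        = range (3 * m * (m + 1) - K) := by
      ext l; simp; omega
    rw [this, card_range]
  rw [this]; omega

lemma blk_var {n m : ℕ} (i : Fin n) (b : Bool) (f : Item n m → ℕ) :
    ∑ y ∈ blk n m i b, ((itemVar y : ℕ) + 1) * f y = ((i : ℕ) + 1) * ∑ y ∈ blk n m i b, f y := by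
  rw [mul_sum]
  refine sum_congr rfl fun y hy => ?_
  simp only [blk, mem_filter] at hy
  rw [hy.2.1]

/-- sums over a selection that agrees with blocks -/
lemma sel_sum {n m : ℕ} (τ : Fin n → Bool) (f : Item n m → ℕ) (P : Fin n → Prop)
    [DecidablePred P] :
    ∑ y ∈ univ.filter (fun y : Item n m => itemPos y = τ (itemVar y) ∧ P (itemVar y)), f y
      = ∑ i ∈ univ.filter P, ∑ y ∈ blk n m i (τ i), f y := by
  rw [← sum_fiberwise_of_maps_to (t := univ.filter P) (g := itemVar)]
  · refine sum_congr rfl fun i hi => ?_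
    refine sum_congr ?_ fun _ _ => rfl
    ext y
    simp only [mem_filter, mem_univ, true_and, blk] at hi ⊢
    constructor
    · rintro ⟨⟨h1, h2⟩, h3⟩; subst h3; exact ⟨rfl, h1⟩
    · rintro ⟨h1, h2⟩; subst h1; exact ⟨⟨h2, hi⟩, rfl⟩
  · intro y hy; simp at hy ⊢; exact hy.2

lemma univ_sum {n m : ℕ} (f : Item n m → ℕ) :
    ∑ y, f y = ∑ i, (∑ y ∈ blk n m i true, f y + ∑ y ∈ blk n m i false, f y) := by
  rw [sum_add_distrib]
  have h1 := sel_sum (m := m) (fun _ : Fin n => true) f (fun _ => True)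
  have h2 := sel_sum (m := m) (fun _ : Fin n => false) f (fun _ => True)
  simp only [and_true, filter_true] at h1 h2
  rw [← h1, ← h2, ← sum_filter_add_sum_filter_not univ (fun y : Item n m => itemPos y = true) f]
  simp

lemma tri_range (n : ℕ) : ∑ i ∈ range n, (i + 1) = n * (n + 1) / 2 := by
  have h := Finset.sum_range_succ' (fun i => i) n
  have h2 := Finset.sum_range_id (n + 1)
  simp only [add_tsub_cancel_right] at h2
  rw [mul_comm n, ← h2, h, add_zero]

lemma tri_eq (n : ℕ) : ∑ i : Fin n, ((i : ℕ) + 1) = n * (n + 1) / 2 := by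
  rw [Fin.sum_univ_eq_sum_range (fun i => i + 1), tri_range]

lemma tri_le (n : ℕ) (hn : 0 < n) : n * (n + 1) / 2 ≤ n ^ 2 := by
  have : n * (n + 1) ≤ n ^ 2 * 2 := by nlinarith
  omega

lemma blk_v1 {n m : ℕ} (i : Fin n) (b : Bool) :
    ∑ y ∈ blk n m i b, ((itemVar y : ℕ) + 1) = ((i : ℕ) + 1) * Nval m := by
  have := blk_var (m := m) i b (fun _ => 1)
  rw [blk_one] at this
  simpa using this

lemma blk_ve {n m : ℕ} (i : Fin n) (b : Bool) :
    ∑ y ∈ blk n m i b, ((itemVar y : ℕ) + 1) * ee y = ((i : ℕ) + 1) * Nval m := by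
  rw [blk_var, blk_ee]

lemma tot_one (n m : ℕ) : ∑ _y : Item n m, 1 = 2 * (Nval m * n) := by
  rw [univ_sum]; simp only [blk_one]; simp; ring

lemma tot_ee (n m : ℕ) : ∑ y : Item n m, ee y = 2 * (Nval m * n) := by
  rw [univ_sum]; simp only [blk_ee]; simp; ring

lemma tot_v (n m : ℕ) :
    ∑ y : Item n m, ((itemVar y : ℕ) + 1) = 2 * (Nval m * (n * (n + 1) / 2)) := by
  rw [univ_sum]; simp only [blk_v1]; rw [sum_add_distrib, ← sum_mul, tri_eq]; ring

lemma tot_ve (n m : ℕ) :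
    ∑ y : Item n m, ((itemVar y : ℕ) + 1) * ee y = 2 * (Nval m * (n * (n + 1) / 2)) := by
  rw [univ_sum]; simp only [blk_ve]; rw [sum_add_distrib, ← sum_mul, tri_eq]; ring

lemma tot_ss {n m : ℕ} (hn : 0 < n) (hm : 0 < m) (c : Fin m → Fin 3 → Fin n × Bool) :
    ∑ y : Item n m, ss c y = 2 * (3 * m * (m + 1) * n) := by
  rw [univ_sum]; simp only [blk_ss hn hm]; simp; ring

lemma Rval_eq (n m : ℕ) : Rval n m = Bval n m ^ 4 * (Nval m * n) + Bval n m ^ 3 * (Nval m * n)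
    + Bval n m ^ 2 * (Nval m * (n * (n + 1) / 2)) + Bval n m * (Nval m * (n * (n + 1) / 2))
    + 3 * m * (m + 1) * n := by
  unfold Rval; ring

lemma tot_p {n m : ℕ} (hn : 0 < n) (hm : 0 < m) (c : Fin m → Fin 3 → Fin n × Bool) :
    ∑ y, p1 n m c y = 2 * Rval n m := by
  rw [p1_sum, tot_one, tot_ee, tot_v, tot_ve, tot_ss hn hm, Rval_eq]; ring

lemma sub_le {n m : ℕ} (S : Finset (Item n m)) (f : Item n m → ℕ) :
    ∑ y ∈ S, f y ≤ ∑ y, f y := sum_le_sum_of_subset (subset_univ S)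

lemma Nn_le {n m : ℕ} (hn : 0 < n) : Nval m * n ≤ Nval m * n ^ 2 :=
  Nat.mul_le_mul_left _ (by nlinarith)

lemma Mn_le {n m : ℕ} (hn : 0 < n) : 3 * m * (m + 1) * n ≤ Nval m * n ^ 2 := by
  refine le_trans ?_ (Nn_le hn)
  exact Nat.mul_le_mul_right _ (by unfold Nval; nlinarith)

lemma NT_le {n m : ℕ} (hn : 0 < n) : Nval m * (n * (n + 1) / 2) ≤ Nval m * n ^ 2 :=
  Nat.mul_le_mul_left _ (tri_le n hn)

lemma bd_ee {n m : ℕ} (hn : 0 < n) (hm : 0 < m) (S : Finset (Item n m)) :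
    4 * ∑ y ∈ S, ee y < Bval n m := by
  have := sub_le S ee
  rw [tot_ee] at this
  have := Bbound n m hn hm
  have := Nn_le (m := m) hn
  omega

lemma bd_v {n m : ℕ} (hn : 0 < n) (hm : 0 < m) (S : Finset (Item n m)) :
    4 * ∑ y ∈ S, ((itemVar y : ℕ) + 1) < Bval n m := by
  have := sub_le S (fun y => (itemVar y : ℕ) + 1)
  rw [tot_v] at this
  have := Bbound n m hn hm
  have := NT_le (m := m) hn
  omega

lemma bd_ve {n m : ℕ} (hn : 0 < n) (hm : 0 < m) (S : Finset (Item n m)) :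
    4 * ∑ y ∈ S, ((itemVar y : ℕ) + 1) * ee y < Bval n m := by
  have := sub_le S (fun y => ((itemVar y : ℕ) + 1) * ee y)
  rw [tot_ve] at this
  have := Bbound n m hn hm
  have := NT_le (m := m) hn
  omega

lemma bd_ss {n m : ℕ} (hn : 0 < n) (hm : 0 < m) (c : Fin m → Fin 3 → Fin n × Bool)
    (S : Finset (Item n m)) : 4 * ∑ y ∈ S, ss c y < Bval n m := by
  have := sub_le S (ss c)
  rw [tot_ss hn hm] at this
  have := Bbound n m hn hm
  have := Mn_le (m := m) hn
  omega

lemma digit1 {B a b x y : ℕ} (hx : x < B) (hy : y < B) (h : B * a + x = B * b + y) :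
    a = b ∧ x = y := by
  have hB : 0 < B := by omega
  have h1 : (B * a + x) / B = a := by
    rw [Nat.mul_add_div hB, Nat.div_eq_of_lt hx, add_zero]
  have h2 : (B * b + y) / B = b := by
    rw [Nat.mul_add_div hB, Nat.div_eq_of_lt hy, add_zero]
  have : a = b := by rw [← h1, ← h2, h]
  subst this
  exact ⟨rfl, by omega⟩

lemma digits {B a4 a3 a2 a1 a0 b4 b3 b2 b1 b0 : ℕ} (h3 : a3 < B) (h2 : a2 < B) (h1 : a1 < B)
    (h0 : a0 < B) (g3 : b3 < B) (g2 : b2 < B) (g1 : b1 < B) (g0 : b0 < B)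
    (h : B ^ 4 * a4 + B ^ 3 * a3 + B ^ 2 * a2 + B * a1 + a0
      = B ^ 4 * b4 + B ^ 3 * b3 + B ^ 2 * b2 + B * b1 + b0) :
    a4 = b4 ∧ a3 = b3 ∧ a2 = b2 ∧ a1 = b1 ∧ a0 = b0 := by
  have e : B * (B * (B * (B * a4 + a3) + a2) + a1) + a0
      = B * (B * (B * (B * b4 + b3) + b2) + b1) + b0 := by linarith
  obtain ⟨e, r0⟩ := digit1 h0 g0 e
  obtain ⟨e, r1⟩ := digit1 h1 g1 e
  obtain ⟨e, r2⟩ := digit1 h2 g2 e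
  obtain ⟨e, r3⟩ := digit1 h3 g3 e
  exact ⟨e, r3, r2, r1, r0⟩

lemma day_le {n m : ℕ} (c : Fin m → Fin 3 → Fin n × Bool) (z : Item n m → Bool) (i : ℕ)
    (hi : i ≤ n) :
    (∑ y : Item n m, if (if z y then a2 n m c y else a1 y) ≤ i then
        (if z y then 2 * p1 n m c y else p1 n m c y) else 0)
    = ∑ y ∈ univ.filter (fun y : Item n m => z y = false ∧ (itemVar y : ℕ) < i), p1 n m c y := by
  rw [sum_filter]
  refine sum_congr rfl fun y _ => ?_
  rw [a2_eq]
  cases h : z y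
  · simp [a1]
  · simp; omega

lemma day_gt {n m : ℕ} (c : Fin m → Fin 3 → Fin n × Bool) (z : Item n m → Bool) (t : ℕ) :
    (∑ y : Item n m, if (if z y then a2 n m c y else a1 y) ≤ n + 1 + t then
        (if z y then 2 * p1 n m c y else p1 n m c y) else 0)
    = ∑ y ∈ univ.filter (fun y : Item n m => z y = false), p1 n m c y
      + 2 * ∑ y ∈ univ.filter (fun y : Item n m => z y = true ∧ ss c y ≤ t), p1 n m c y := by
  rw [sum_filter, sum_filter, mul_sum, ← sum_add_distrib]
  refine sum_congr rfl fun y _ => ?_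
  rw [a2_eq]
  cases h : z y
  · have := (itemVar y).2
    simp [a1]; omega
  · simp

lemma abel_sum (g : ℕ → ℤ) (n : ℕ) : ∑ k ∈ range n, ((k : ℤ) + 1) * g k
    = n * (∑ k ∈ range n, g k) - ∑ i ∈ range n, ∑ k ∈ range i, g k := by
  induction n with
  | zero => simp
  | succ n ih => rw [sum_range_succ, ih, sum_range_succ, sum_range_succ]; push_cast; ring

lemma pre_sum {n m : ℕ} (S : Finset (Item n m)) (f : Item n m → ℕ) (i : ℕ) :
    ∑ k ∈ range i, ∑ y ∈ S with (itemVar y : ℕ) = k, f y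
      = ∑ y ∈ S with (itemVar y : ℕ) < i, f y := by
  rw [← sum_fiberwise_of_maps_to (s := S.filter fun y => (itemVar y : ℕ) < i) (t := range i)
    (g := fun y => (itemVar y : ℕ))]
  · refine sum_congr rfl fun k hk => sum_congr ?_ fun _ _ => rfl
    ext y
    simp at hk ⊢
    intro _; omega
  · intro y hy; simp at hy ⊢; exact hy.2

lemma fib {n m : ℕ} (S : Finset (Item n m)) (f : Item n m → ℕ)
    (hpre : ∀ i < n, ∑ y ∈ S with (itemVar y : ℕ) < i, f y ≤ Nval m * i)
    (htot : ∑ y ∈ S, f y = Nval m * n)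
    (hw : ∑ y ∈ S, ((itemVar y : ℕ) + 1) * f y = Nval m * (n * (n + 1) / 2)) :
    (∀ i ≤ n, ∑ y ∈ S with (itemVar y : ℕ) < i, f y = Nval m * i) ∧
    ∀ i < n, ∑ y ∈ S with (itemVar y : ℕ) = i, f y = Nval m := by
  have hall : ∀ F : Item n m → ℕ, ∑ y ∈ S with (itemVar y : ℕ) < n, F y = ∑ y ∈ S, F y := by
    intro F
    rw [filter_true_of_mem]
    intro y _; exact (itemVar y).2
  set g : ℕ → ℤ := fun k => (Nval m : ℤ) - ((∑ y ∈ S with (itemVar y : ℕ) = k, f y : ℕ) : ℤ)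
    with hg
  have hG : ∀ i, ∑ k ∈ range i, g k
      = (Nval m : ℤ) * i - ((∑ y ∈ S with (itemVar y : ℕ) < i, f y : ℕ) : ℤ) := by
    intro i
    rw [← pre_sum, hg, sum_sub_distrib]
    push_cast; simp; ring
  have hW : ∑ k ∈ range n, ((k : ℤ) + 1) * g k = 0 := by
    have e1 : ∑ k ∈ range n, (k + 1) * ∑ y ∈ S with (itemVar y : ℕ) = k, f y
        = Nval m * (n * (n + 1) / 2) := by
      rw [← hw, ← hall, ← pre_sum]
      refine sum_congr rfl fun k _ => ?_
      rw [mul_sum]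
      refine sum_congr rfl fun y hy => ?_
      simp at hy; rw [hy.2]
    have e2 : ∑ k ∈ range n, (k + 1) * Nval m = Nval m * (n * (n + 1) / 2) := by
      rw [← sum_mul, tri_range, mul_comm]
    simp only [hg, mul_sub, sum_sub_distrib]
    have e3 : ((∑ k ∈ range n, (k + 1) * Nval m : ℕ) : ℤ)
      = ((∑ k ∈ range n, (k + 1) * ∑ y ∈ S with (itemVar y : ℕ) = k, f y : ℕ) : ℤ) := by
      rw [e1, e2]
    push_cast at e3 ⊢
    linarith
  rw [abel_sum, hG n, hall, htot] at hW
  have hz : ∑ i ∈ range n, ∑ k ∈ range i, g k = 0 := by push_cast at hW; linarith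
  rw [sum_eq_zero_iff_of_nonneg] at hz
  · have h1 : ∀ i ≤ n, ∑ y ∈ S with (itemVar y : ℕ) < i, f y = Nval m * i := by
      intro i hi
      rcases hi.lt_or_eq with h | h
      · have := hz i (by simpa using h)
        rw [hG] at this
        generalize (∑ y ∈ S with (itemVar y : ℕ) < i, f y) = q at this ⊢
        have h' : (q : ℤ) = (Nval m : ℤ) * i := by linarith
        exact_mod_cast h'
      · subst h; rw [hall, htot]
    refine ⟨h1, fun i hi => ?_⟩
    have := h1 (i + 1) hi
    rw [← pre_sum, sum_range_succ, pre_sum, h1 i hi.le] at this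
    linarith
  · intro i hi
    rw [hG]
    have := hpre i (by simpa using hi)
    generalize (∑ y ∈ S with (itemVar y : ℕ) < i, f y) = q at this ⊢
    have h' : (q : ℤ) ≤ (Nval m : ℤ) * i := by exact_mod_cast this
    linarith

lemma dig_R {n m : ℕ} (hn : 0 < n) (hm : 0 < m) (c : Fin m → Fin 3 → Fin n × Bool)
    (S : Finset (Item n m)) (h : ∑ y ∈ S, p1 n m c y = Rval n m) :
    ∑ _y ∈ S, 1 = Nval m * n ∧ ∑ y ∈ S, ee y = Nval m * n ∧
    ∑ y ∈ S, ((itemVar y : ℕ) + 1) = Nval m * (n * (n + 1) / 2) ∧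
    ∑ y ∈ S, ((itemVar y : ℕ) + 1) * ee y = Nval m * (n * (n + 1) / 2) ∧
    ∑ y ∈ S, ss c y = 3 * m * (m + 1) * n := by
  rw [p1_sum, Rval_eq] at h
  have := Bbound n m hn hm
  have := NT_le (m := m) hn
  have := Nn_le (m := m) hn
  have := Mn_le (m := m) hn
  have := bd_ee hn hm S
  have := bd_v hn hm S
  have := bd_ve hn hm S
  have := bd_ss hn hm c S
  exact digits (by omega) (by omega) (by omega) (by omega) (by omega) (by omega) (by omega)
    (by omega) h

lemma halves {n m : ℕ} (hn : 0 < n) (hm : 0 < m) (c : Fin m → Fin 3 → Fin n × Bool)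
    (z : Item n m → Bool) (hz : Feasible n m c z) :
    ∑ y ∈ univ.filter (fun y : Item n m => z y = true), p1 n m c y = Rval n m ∧
    ∑ y ∈ univ.filter (fun y : Item n m => z y = false), p1 n m c y = Rval n m := by
  have h1 := hz n hn (by omega)
  have h2 := hz (n + m + 2) (by omega) (by omega)
  rw [day_le c z n le_rfl] at h1
  rw [show n + m + 2 = n + 1 + (m + 1) by ring, day_gt c z (m + 1)] at h2
  have e1 : qv n m n = Rval n m := by simp [qv]
  have e2 : qv n m (n + 1 + (m + 1)) = 3 * Rval n m := by
    unfold qv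
    rw [if_neg (by omega), if_neg (by omega), if_neg (by omega), if_neg (by omega)]
  rw [e1] at h1
  rw [e2] at h2
  have hv : ∀ y : Item n m, (itemVar y : ℕ) < n := fun y => (itemVar y).2
  simp only [ss_le, hv, and_true] at h1 h2
  have h3 := tot_p hn hm c
  rw [← sum_filter_add_sum_filter_not univ (fun y : Item n m => z y = true)] at h3
  simp only [Bool.not_eq_true] at h3
  omega

lemma initial_bd {n m : ℕ} (hn : 0 < n) (hm : 0 < m) (c : Fin m → Fin 3 → Fin n × Bool)
    (S : Finset (Item n m)) (i : ℕ) (hi : i < n)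
    (h : ∑ y ∈ S, p1 n m c y ≤ Nval m * (Bval n m + 1) * i * Bval n m ^ 3 + (Bval n m ^ 3 - 1)) :
    ∑ _y ∈ S, 1 ≤ Nval m * i ∧ (∑ _y ∈ S, 1 = Nval m * i → ∑ y ∈ S, ee y ≤ Nval m * i) := by
  rw [p1_sum] at h
  have hB := Bbound n m hn hm
  have hN := Nn_le (m := m) hn
  have hNi : Nval m * i ≤ Nval m * n := Nat.mul_le_mul_left _ hi.le
  generalize (∑ _y ∈ S, 1) = A at *
  generalize (∑ y ∈ S, ee y) = C at *
  generalize Nval m = N at *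
  generalize Bval n m = B at *
  have hB3 : 0 < B ^ 3 := by have : 0 < B := by omega
                             positivity
  have k : B * A + C < B * (N * i) + N * i + 1 := by
    have : B ^ 3 * (B * A + C) < B ^ 3 * (B * (N * i) + N * i + 1) := by
      have e1 : B ^ 3 * (B * A + C) = B ^ 4 * A + B ^ 3 * C := by ring
      have e2 : B ^ 3 * (B * (N * i) + N * i + 1) = N * (B + 1) * i * B ^ 3 + B ^ 3 := by ring
      omega
    exact Nat.lt_of_mul_lt_mul_left this
  constructor
  · have : B * A < B * (N * i + 1) := by rw [mul_add]; omega
    have := Nat.lt_of_mul_lt_mul_left this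
    omega
  · intro hA; rw [hA] at k; omega

lemma dichot {n m : ℕ} (z : Item n m → Bool) (i : Fin n)
    (h1 : ∑ _y ∈ univ.filter (fun y : Item n m => z y = false ∧ itemVar y = i), 1 = Nval m)
    (h2 : ∑ y ∈ univ.filter (fun y : Item n m => z y = false ∧ itemVar y = i), ee y = Nval m) :
    (∀ y : Item n m, itemVar y = i → z y = itemPos y) ∨
    (∀ y : Item n m, itemVar y = i → z y = !itemPos y) := by
  have hsplit : ∀ f : Item n m → ℕ,
      ∑ y ∈ univ.filter (fun y : Item n m => z y = false ∧ itemVar y = i), f y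
      = ∑ y ∈ blk n m i true with z y = false, f y
        + ∑ y ∈ blk n m i false with z y = false, f y := by
    intro f
    rw [← sum_filter_add_sum_filter_not _ (fun y : Item n m => itemPos y = true)]
    unfold blk
    simp only [filter_filter, Bool.not_eq_true]
    congr 1 <;> refine sum_congr ?_ fun _ _ => rfl <;> ext y <;> simp <;> tauto
  rw [hsplit] at h1 h2
  have ht : ∑ y ∈ blk n m i true with z y = false, ee y
      = ∑ y ∈ blk n m i true with z y = false, 1 := by
    refine sum_congr rfl fun y hy => ?_
    simp only [blk, mem_filter, mem_univ, true_and] at hy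
    rcases y with ⟨i, j, k, pos⟩ | ⟨i, l, pos⟩ <;> simp [itemPos] at hy <;> simp [ee, hy]
  rw [ht] at h2
  have hc : ∀ b, (blk n m i b).card = Nval m := fun b => by
    rw [← blk_one i b]; simp
  simp only [sum_const, smul_eq_mul, mul_one] at h1 h2
  have hzero : ∀ b, ((blk n m i b).filter fun y => z y = false).card = 0 →
      ∀ y : Item n m, itemVar y = i → itemPos y = b → z y = true := by
    intro b hb y hy1 hy2
    rw [card_eq_zero, filter_eq_empty_iff] at hb
    have := hb (x := y) (by simp [blk, hy1, hy2])
    simpa using this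
  have hfull : ∀ b, ((blk n m i b).filter fun y => z y = false).card = Nval m →
      ∀ y : Item n m, itemVar y = i → itemPos y = b → z y = false := by
    intro b hb y hy1 hy2
    rw [← hc b, card_filter_eq_iff] at hb
    exact hb y (by simp [blk, hy1, hy2])
  let y0 : Item n m := Sum.inr (i, Fin.last _, false)
  have hy0 : ee y0 = Nval m := by simp [y0, ee]
  cases hz : z y0
  · left
    have h3 : Nval m ≤ ∑ y ∈ blk n m i false with z y = false, ee y := by
      rw [← hy0]
      exact single_le_sum (f := ee) (fun _ _ => Nat.zero_le _)
        (by simp [hz, blk]; simp [y0, itemVar, itemPos])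
    have a0 := hzero true (by omega)
    have b0 := hfull false (by omega)
    intro y hy
    cases hp : itemPos y
    · exact b0 y hy hp
    · exact a0 y hy hp
  · right
    have h3 : ∑ y ∈ blk n m i false with z y = false, ee y = 0 := by
      refine sum_eq_zero fun y hy => ?_
      simp only [blk, mem_filter, mem_univ, true_and] at hy
      obtain ⟨⟨hy1, hy2⟩, hy3⟩ := hy
      rcases y with ⟨i', j, k, pos⟩ | ⟨i', l, pos⟩
      · simp [itemPos] at hy2; simp [ee, hy2]
      · simp only [itemPos, itemVar] at hy1 hy2
        subst hy1 hy2
        by_cases hl : (l : ℕ) + 1 ≤ 3 * m * (m + 1)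
        · simp only [ee]; rw [if_neg (by simp), if_pos hl]
        · have : l = Fin.last _ := by ext; have := l.2; simp; omega
          rw [this] at hy3
          simp only [y0] at hz
          rw [hz] at hy3
          cases hy3
    have a0 := hfull true (by omega)
    have b0 := hzero false (by omega)
    intro y hy
    cases hp : itemPos y
    · exact b0 y hy hp
    · exact a0 y hy hp

lemma var_dichotomy {n m : ℕ} (hn : 0 < n) (hm : 0 < m) (c : Fin m → Fin 3 → Fin n × Bool)
    (z : Item n m → Bool) (hz : Feasible n m c z) (i : Fin n) :
    (∀ y : Item n m, itemVar y = i → z y = itemPos y) ∨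
    (∀ y : Item n m, itemVar y = i → z y = !itemPos y) := by
  have hR := (halves hn hm c z hz).2
  obtain ⟨d4, d3, d2, d1, -⟩ := dig_R hn hm c _ hR
  have hday : ∀ i < n, 0 < i → _ := fun i hi hi0 => initial_bd hn hm c
    (univ.filter (fun y : Item n m => z y = false ∧ (itemVar y : ℕ) < i)) i hi (by
      have := hz i hi0 (by omega)
      rw [day_le c z i hi.le] at this
      simpa only [qv, if_pos hi] using this)
  have A := fib (univ.filter (fun y : Item n m => z y = false)) (fun _ => 1) (by
    intro i hi
    rcases Nat.eq_zero_or_pos i with h | h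
    · subst h; simp
    · rw [filter_filter]; exact (hday i hi h).1) d4 (by simpa using d2)
  have C := fib (univ.filter (fun y : Item n m => z y = false)) ee (by
    intro i hi
    rcases Nat.eq_zero_or_pos i with h | h
    · subst h; simp
    · rw [filter_filter]
      refine (hday i hi h).2 ?_
      have := A.1 i hi.le
      rwa [filter_filter] at this) d3 d1
  apply dichot
  · have := A.2 i i.2
    rw [filter_filter] at this
    simpa only [Fin.val_inj] using this
  · have := C.2 i i.2
    rw [filter_filter] at this
    simpa only [Fin.val_inj] using this

lemma low_lt {B e v w s : ℕ} (he : e < B) (hv : v < B) (hw : w < B) (hs : s < B) :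
    B ^ 3 * e + B ^ 2 * v + B * w + s < B ^ 4 := by
  have h1 : B * w + s < B ^ 2 := by nlinarith
  have h2 : B ^ 2 * v + (B * w + s) < B ^ 3 := by
    have : B ^ 2 * (v + 1) ≤ B ^ 2 * B := Nat.mul_le_mul_left _ hv
    nlinarith
  have : B ^ 3 * (e + 1) ≤ B ^ 3 * B := Nat.mul_le_mul_left _ he
  nlinarith

lemma day_iff {n m : ℕ} (hn : 0 < n) (hm : 0 < m) (c : Fin m → Fin 3 → Fin n × Bool)
    (S S' : Finset (Item n m)) (Q : ℕ) :
    ∑ y ∈ S, p1 n m c y + 2 * ∑ y ∈ S', p1 n m c y ≤ Q * Bval n m ^ 4 + (Bval n m ^ 4 - 1) ↔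
    S.card + 2 * S'.card ≤ Q := by
  have hB := B_gt n m hn hm
  have a1 := bd_ee hn hm S
  have a2 := bd_v hn hm S
  have a3 := bd_ve hn hm S
  have a4 := bd_ss hn hm c S
  have b1 := bd_ee hn hm S'
  have b2 := bd_v hn hm S'
  have b3 := bd_ve hn hm S'
  have b4 := bd_ss hn hm c S'
  have hlow := low_lt (B := Bval n m) (e := ∑ y ∈ S, ee y + 2 * ∑ y ∈ S', ee y)
    (v := ∑ y ∈ S, ((itemVar y : ℕ) + 1) + 2 * ∑ y ∈ S', ((itemVar y : ℕ) + 1))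
    (w := ∑ y ∈ S, ((itemVar y : ℕ) + 1) * ee y + 2 * ∑ y ∈ S', ((itemVar y : ℕ) + 1) * ee y)
    (s := ∑ y ∈ S, ss c y + 2 * ∑ y ∈ S', ss c y) (by omega) (by omega) (by omega) (by omega)
  have e : ∑ y ∈ S, p1 n m c y + 2 * ∑ y ∈ S', p1 n m c y
      = Bval n m ^ 4 * (S.card + 2 * S'.card) + (Bval n m ^ 3 * (∑ y ∈ S, ee y + 2 * ∑ y ∈ S', ee y)
    + Bval n m ^ 2 * (∑ y ∈ S, ((itemVar y : ℕ) + 1) + 2 * ∑ y ∈ S', ((itemVar y : ℕ) + 1))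
    + Bval n m * (∑ y ∈ S, ((itemVar y : ℕ) + 1) * ee y + 2 * ∑ y ∈ S', ((itemVar y : ℕ) + 1) * ee y)
    + (∑ y ∈ S, ss c y + 2 * ∑ y ∈ S', ss c y)) := by
    rw [p1_sum, p1_sum, sum_const, sum_const, smul_eq_mul, smul_eq_mul, mul_one, mul_one]; ring
  rw [e]
  generalize (Bval n m ^ 3 * _ + _ + _ + _) = low at hlow ⊢
  generalize S.card + 2 * S'.card = C
  generalize Bval n m ^ 4 = P at hlow ⊢
  constructor
  · intro h
    have : P * C < P * (Q + 1) := by rw [mul_add, mul_comm P Q]; omega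
    have := Nat.lt_of_mul_lt_mul_left this
    omega
  · intro h
    have : P * C ≤ P * Q := Nat.mul_le_mul_left _ h
    rw [mul_comm Q]; omega

lemma D_sum {n m : ℕ} (c : Fin m → Fin 3 → Fin n × Bool) (X : Finset (Item n m)) :
    ∑ t ∈ Icc 1 m, (X.filter fun y => t < ss c y).card = ∑ y ∈ X, (ss c y - 1) := by
  simp only [card_filter]
  rw [sum_comm]
  refine sum_congr rfl fun y _ => ?_
  have hs := ss_le c y
  rw [← card_filter]
  have : filter (fun t => t < ss c y) (Icc 1 m) = Icc 1 (ss c y - 1) := by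
    ext t; simp; omega
  rw [this]; simp

lemma Z0_card {n m : ℕ} (c : Fin m → Fin 3 → Fin n × Bool) (X : Finset (Item n m))
    (h1 : ∑ _y ∈ X, 1 = Nval m * n) (h2 : ∑ y ∈ X, ss c y = 3 * m * (m + 1) * n) :
    (X.filter fun y => ss c y ≤ 0).card
      = 3 * m * n + n + ∑ t ∈ Icc 1 m, (X.filter fun y => t < ss c y).card := by
  rw [D_sum, card_filter]
  have : ∑ y ∈ X, 1 + ∑ y ∈ X, (ss c y - 1) = ∑ y ∈ X, ss c y
      + ∑ y ∈ X, (if ss c y ≤ 0 then 1 else 0) := by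
    rw [← sum_add_distrib, ← sum_add_distrib]
    refine sum_congr rfl fun y _ => ?_
    split_ifs <;> omega
  have e : Nval m * n = 3 * m * (m + 1) * n + (3 * m * n + n) := by unfold Nval; ring
  omega

lemma D_compl {n m : ℕ} (c : Fin m → Fin 3 → Fin n × Bool) (X : Finset (Item n m)) (t : ℕ) :
    (X.filter fun y => ss c y ≤ t).card + (X.filter fun y => t < ss c y).card = X.card := by
  have := card_filter_add_card_filter_not (s := X) (fun y => ss c y ≤ t)
  simpa only [not_le] using this

lemma D_succ {n m : ℕ} (c : Fin m → Fin 3 → Fin n × Bool) (X : Finset (Item n m)) (t : ℕ) :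
    (X.filter fun y => t < ss c y).card
      = (X.filter fun y => ss c y = t + 1).card + (X.filter fun y => t + 1 < ss c y).card := by
  simp only [card_filter]
  rw [← sum_add_distrib]
  refine sum_congr rfl fun y _ => ?_
  split_ifs <;> omega

lemma D_last {n m : ℕ} (c : Fin m → Fin 3 → Fin n × Bool) (X : Finset (Item n m)) :
    (X.filter fun y => m + 1 < ss c y).card = 0 := by
  rw [card_eq_zero, filter_eq_empty_iff]
  intro y _; have := ss_le c y; omega

/-- The item of the `k`-th literal of clause `j`. -/
def lit {n m : ℕ} (c : Fin m → Fin 3 → Fin n × Bool) (j : Fin m) (k : Fin 3) : Item n m :=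
  Sum.inl ((c j k).1, j, k, (c j k).2)

lemma clause_card {n m : ℕ} (c : Fin m → Fin 3 → Fin n × Bool) (z : Item n m → Bool)
    (j : Fin m) :
    ((univ.filter fun y : Item n m => z y = true).filter fun y => ss c y = j + 1 + 1).card
      = (univ.filter fun k : Fin 3 => z (lit c j k) = true).card := by
  symm
  refine card_bij (fun k _ => lit c j k) ?_ ?_ ?_
  · intro k hk
    simp only [mem_filter, mem_univ, true_and] at hk ⊢
    exact ⟨hk, by simp [lit, ss]⟩
  · intro k _ k' _ h
    simp [lit] at h
    exact h.2.1
  · intro y hy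
    simp only [mem_filter, mem_univ, true_and] at hy
    obtain ⟨h1, h2⟩ := hy
    rcases y with ⟨i, j', k, pos⟩ | ⟨i, l, pos⟩
    · simp only [ss] at h2
      split_ifs at h2 with h
      have : j' = j := by ext; omega
      subst this
      have e : lit c j' k = Sum.inl (i, j', k, pos) := by simp [lit, h]
      exact ⟨k, by simp [e, h1], e⟩
    · simp only [ss] at h2
      split_ifs at h2 <;> omega

lemma sum_down (m : ℕ) : 2 * ∑ t ∈ Icc 1 m, (m + 1 - t) = m * (m + 1) := by
  have h : ∑ t ∈ Icc 1 m, (m + 1 - t) = ∑ t ∈ range m, (t + 1) := by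
    refine sum_bij' (fun t _ => m - t) (fun t _ => m - t) ?_ ?_ ?_ ?_ ?_ <;>
      intro t ht <;> simp at ht ⊢ <;> omega
  rw [h, tri_range]
  have : 2 ∣ m * (m + 1) := (Nat.even_mul_succ_self m).two_dvd
  omega

lemma qv0 (n m : ℕ) : qv n m (n + 1 + 0) =
    (Nval m * n + 6 * m * n + 2 * n + m * (m + 1)) * Bval n m ^ 4 + (Bval n m ^ 4 - 1) := by
  unfold qv
  rw [if_neg (by omega), if_neg (by omega), if_pos (by omega)]

lemma qvt (n m t : ℕ) (h1 : 1 ≤ t) (h2 : t ≤ m) : qv n m (n + 1 + t) =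
    (3 * Nval m * n - 2 * (m + 1 - t)) * Bval n m ^ 4 + (Bval n m ^ 4 - 1) := by
  unfold qv
  rw [if_neg (by omega), if_neg (by omega), if_neg (by omega), if_pos (by omega)]
  rw [show n + m + 2 - (n + 1 + t) = m + 1 - t by omega]

lemma forward {n m : ℕ} (hn : 0 < n) (hm : 0 < m) (c : Fin m → Fin 3 → Fin n × Bool)
    (z : Item n m → Bool) (hz : Feasible n m c z) (j : Fin m) :
    (univ.filter fun k : Fin 3 => z (lit c j k) = true).card = 1 := by
  obtain ⟨hX, hY⟩ := halves hn hm c z hz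
  obtain ⟨x4, -, -, -, x0⟩ := dig_R hn hm c _ hX
  obtain ⟨y4, -, -, -, -⟩ := dig_R hn hm c _ hY
  have hZ := Z0_card c _ x4 x0
  rw [sum_const, smul_eq_mul, mul_one] at x4 y4
  rw [← clause_card]
  have h0 := hz (n + 1 + 0) (by omega) (by omega)
  rw [day_gt, qv0, day_iff hn hm, y4, ← filter_filter, hZ] at h0
  set X := univ.filter (fun y : Item n m => z y = true) with hXdef
  have hge : ∀ t ∈ Icc 1 m, m + 1 - t ≤ (X.filter fun y => t < ss c y).card := by
    intro t ht
    rw [mem_Icc] at ht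
    have h := hz (n + 1 + t) (by omega) (by omega)
    rw [day_gt, qvt _ _ _ ht.1 ht.2, day_iff hn hm, y4, ← filter_filter] at h
    have h' := D_compl c X t
    have e : 3 * Nval m * n = 3 * (Nval m * n) := by ring
    have : m + 1 ≤ Nval m * n := by
      have : m + 1 ≤ Nval m := by unfold Nval; nlinarith
      nlinarith
    rw [← hXdef] at h
    omega
  have hs := sum_down m
  have hle : ∑ t ∈ Icc 1 m, (X.filter fun y => t < ss c y).card ≤ ∑ t ∈ Icc 1 m, (m + 1 - t) := by
    have e : 6 * m * n = 2 * (3 * m * n) := by ring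
    omega
  have heq := (sum_eq_sum_iff_of_le hge).1 (le_antisymm (sum_le_sum hge) hle)
  have hj := j.2
  have hD1 := heq (j + 1) (mem_Icc.2 ⟨by omega, by omega⟩)
  have hD2 := D_succ c X (j + 1)
  have hD3 : (X.filter fun y => (j : ℕ) + 1 + 1 < ss c y).card = m + 1 - (j + 2) := by
    rcases Nat.lt_or_ge (j + 1) m with h | h
    · rw [← heq (j + 1 + 1) (by simp; omega)]
    · have : (j : ℕ) + 1 = m := by omega
      rw [this, D_last]; omega
  omega

lemma forward_sat {n m : ℕ} (hn : 0 < n) (hm : 0 < m) (c : Fin m → Fin 3 → Fin n × Bool)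
    (z : Item n m → Bool) (hz : Feasible n m c z) (j : Fin m) :
    (Finset.univ.filter fun k : Fin 3 =>
        (decide (Xset n m z ∩ Yset n m (c j k).1 = Tset n m (c j k).1)) = (c j k).2).card
        = 1 := by
  refine Eq.trans ?_ (forward hn hm c z hz j)
  congr 1
  refine filter_congr fun k _ => ?_
  rcases var_dichotomy hn hm c z hz (c j k).1 with h | h
  · have e : Xset n m z ∩ Yset n m (c j k).1 = Tset n m (c j k).1 := by
      ext y
      simp only [Xset, Yset, Tset, mem_inter, mem_filter, mem_univ, true_and]
      constructor
      · rintro ⟨h1, h2⟩; exact ⟨h2, by rw [← h y h2, h1]⟩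
      · rintro ⟨h1, h2⟩; exact ⟨by rw [h y h1, h2], h1⟩
    rw [h (lit c j k) rfl]
    rw [decide_eq_true e]; change _ ↔ (c j k).2 = true; exact eq_comm
  · have e : Xset n m z ∩ Yset n m (c j k).1 ≠ Tset n m (c j k).1 := by
      intro e
      let y : Item n m := Sum.inr ((c j k).1, 0, true)
      have hy : y ∈ Tset n m (c j k).1 := by exact mem_filter.2 ⟨mem_univ _, rfl, rfl⟩
      rw [← e] at hy
      simp only [Xset, Yset, mem_inter, mem_filter, mem_univ, true_and] at hy
      have := h y hy.2
      rw [hy.1] at this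
      simp [y, itemPos] at this
    rw [h (lit c j k) rfl]
    rw [decide_eq_false e]; change _ ↔ (!(c j k).2) = true; cases (c j k).2 <;> simp

lemma backward {n m : ℕ} (hn : 0 < n) (hm : 0 < m) (c : Fin m → Fin 3 → Fin n × Bool)
    (σ : Fin n → Bool)
    (hσ : ∀ j : Fin m, (univ.filter fun k : Fin 3 => σ (c j k).1 = (c j k).2).card = 1) :
    Feasible n m c (fun y => itemPos y == σ (itemVar y)) := by
  set z : Item n m → Bool := fun y => itemPos y == σ (itemVar y) with hzdef
  have hzt : ∀ y, z y = true ↔ itemPos y = σ (itemVar y) := by intro y; simp [hzdef]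
  have hzf : ∀ y, z y = false ↔ itemPos y = !σ (itemVar y) := by
    intro y; simp only [hzdef]; cases itemPos y <;> cases σ (itemVar y) <;> simp
  have sX : ∀ f : Item n m → ℕ, ∑ y ∈ univ.filter (fun y : Item n m => z y = true), f y
      = ∑ i, ∑ y ∈ blk n m i (σ i), f y := by
    intro f
    have := sel_sum σ f (fun _ => True)
    simp only [and_true, filter_true] at this
    simp only [hzt]; exact this
  have sY : ∀ (i : ℕ) (f : Item n m → ℕ),
      ∑ y ∈ univ.filter (fun y : Item n m => z y = false ∧ (itemVar y : ℕ) < i), f y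
      = ∑ k ∈ univ.filter (fun k : Fin n => (k : ℕ) < i), ∑ y ∈ blk n m k (!σ k), f y := by
    intro i f
    have := sel_sum (fun k => !σ k) f (fun k => (k : ℕ) < i)
    simp only [hzf]; exact this
  have hv : ∀ y : Item n m, (itemVar y : ℕ) < n := fun y => (itemVar y).2
  have hvf : ∀ y : Fin n, (y : ℕ) < n := fun y => y.2
  have x4 : ∑ _y ∈ univ.filter (fun y : Item n m => z y = true), 1 = Nval m * n := by
    rw [sX]; simp only [blk_one]; simp; ring
  have x0 : ∑ y ∈ univ.filter (fun y : Item n m => z y = true), ss c y = 3 * m * (m + 1) * n := by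
    rw [sX]; simp only [blk_ss hn hm]; simp; ring
  have hpX : ∑ y ∈ univ.filter (fun y : Item n m => z y = true), p1 n m c y = Rval n m := by
    rw [p1_sum, x4, x0, sX, sX, sX, Rval_eq]
    simp only [blk_ee, blk_v1, blk_ve]
    rw [← sum_mul, tri_eq]; simp; ring
  have htot := tot_p hn hm c
  rw [← sum_filter_add_sum_filter_not univ (fun y : Item n m => z y = true), hpX] at htot
  simp only [Bool.not_eq_true] at htot
  have hpY : ∑ y ∈ univ.filter (fun y : Item n m => z y = false), p1 n m c y = Rval n m := by
    omega
  obtain ⟨y4, -⟩ := dig_R hn hm c _ hpY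
  have hZ := Z0_card c _ x4 x0
  rw [sum_const, smul_eq_mul, mul_one] at x4 y4
  have hcl : ∀ j : Fin m, ((univ.filter fun y : Item n m => z y = true).filter
      fun y => ss c y = j + 1 + 1).card = 1 := by
    intro j
    rw [clause_card, ← hσ j]
    congr 1
    refine filter_congr fun k _ => ?_
    rw [hzt]; simp [lit, itemPos, itemVar, eq_comm]
  set X := univ.filter (fun y : Item n m => z y = true) with hXdef
  have hD : ∀ d ≤ m, (X.filter fun y => m + 1 - d < ss c y).card = d := by
    intro d
    induction d with
    | zero => intro _; exact D_last c X
    | succ d ih =>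
      intro hd
      have h1 := D_succ c X (m + 1 - (d + 1))
      have h2 := hcl ⟨m - (d + 1), by omega⟩
      rw [show m + 1 - (d + 1) + 1 = m + 1 - d by omega, ih (by omega)] at h1
      simp only [show m - (d + 1) + 1 + 1 = m + 1 - d by omega] at h2
      omega
  have hD' : ∀ t ∈ Icc 1 m, (X.filter fun y => t < ss c y).card = m + 1 - t := by
    intro t ht
    rw [mem_Icc] at ht
    have := hD (m + 1 - t) (by omega)
    rwa [show m + 1 - (m + 1 - t) = t by omega] at this
  have hsum : ∑ t ∈ Icc 1 m, (X.filter fun y => t < ss c y).card = ∑ t ∈ Icc 1 m, (m + 1 - t) :=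
    sum_congr rfl hD'
  rw [hsum] at hZ
  have hs := sum_down m
  intro i hi1 hi2
  rcases Nat.lt_trichotomy i n with hi | hi | hi
  · rw [day_le c z i hi.le, qv, if_pos hi, p1_sum, sY i (fun _ => 1), sY i ee]
    simp only [blk_one, blk_ee]
    have hc : (univ.filter (fun k : Fin n => (k : ℕ) < i)).card = i := by
      rw [Fin.card_filter_val_lt]; omega
    rw [sum_const, hc, smul_eq_mul]
    generalize (univ.filter fun y : Item n m => z y = false ∧ (itemVar y : ℕ) < i) = S
    have a2 := bd_v hn hm S
    have a3 := bd_ve hn hm S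
    have a4 := bd_ss hn hm c S
    generalize (∑ y ∈ S, ((itemVar y : ℕ) + 1)) = v at *
    generalize (∑ y ∈ S, ((itemVar y : ℕ) + 1) * ee y) = w at *
    generalize (∑ y ∈ S, ss c y) = s at *
    generalize Bval n m = B at *
    have h1 : B * w + s < B ^ 2 := by nlinarith
    have h2 : B ^ 2 * v + (B * w + s) < B ^ 3 := by
      have : B ^ 2 * (v + 1) ≤ B ^ 2 * B := Nat.mul_le_mul_left _ (by omega)
      nlinarith
    have e : Nval m * (B + 1) * i * B ^ 3 = B ^ 4 * (i * Nval m) + B ^ 3 * (i * Nval m) := by ring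
    rw [e]; omega
  · subst hi
    rw [day_le c z i le_rfl]
    simp only [hv, and_true, hpY]
    simp [qv]
  · obtain ⟨t, rfl⟩ : ∃ t, i = n + 1 + t := ⟨i - (n + 1), by omega⟩
    rcases Nat.eq_zero_or_pos t with ht | ht
    · subst ht
      rw [day_gt, qv0, day_iff hn hm, y4, ← filter_filter, ← hXdef, hZ]
      have e : 6 * m * n = 2 * (3 * m * n) := by ring
      omega
    · rcases Nat.lt_or_ge m t with ht2 | ht2
      · have : t = m + 1 := by omega
        subst this
        rw [day_gt]
        simp only [ss_le, and_true]
        rw [← hXdef, hpX, hpY]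
        unfold qv
        rw [if_neg (by omega), if_neg (by omega), if_neg (by omega), if_neg (by omega)]
        omega
      · rw [day_gt, qvt _ _ _ ht ht2, day_iff hn hm, y4, ← filter_filter, ← hXdef]
        have h' := D_compl c X t
        rw [hD' t (by simp; omega), x4] at h'
        have e : 3 * Nval m * n = 3 * (Nval m * n) := by ring
        omega

/-- The constructed arrears instance `I′` has a feasible solution iff the 1-IN-3SAT
instance is a yes-instance (some truth assignment makes exactly one literal of every
clause true).  Moreover, from any feasible solution a satisfying assignment is obtained
by setting `xᵢ` true iff `X ∩ Y_i = T_i`. -/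
theorem feasible_iff_one_in_three_sat (n m : ℕ) (hn : 0 < n) (hm : 0 < m)
    (c : Fin m → Fin 3 → Fin n × Bool) :
    ((∃ z : Item n m → Bool, Feasible n m c z) ↔
      (∃ σ : Fin n → Bool, ∀ j : Fin m,
        (Finset.univ.filter fun k : Fin 3 => σ (c j k).1 = (c j k).2).card = 1)) ∧
    (∀ z : Item n m → Bool, Feasible n m c z → ∀ j : Fin m,
      (Finset.univ.filter fun k : Fin 3 =>
        (decide (Xset n m z ∩ Yset n m (c j k).1 = Tset n m (c j k).1)) = (c j k).2).card
        = 1) := by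
  refine ⟨⟨?_, ?_⟩, fun z hz j => forward_sat hn hm c z hz j⟩
  · rintro ⟨z, hz⟩
    exact ⟨fun i => decide (Xset n m z ∩ Yset n m i = Tset n m i),
      fun j => forward_sat hn hm c z hz j⟩
  · rintro ⟨σ, hσ⟩
    exact ⟨_, backward hn hm c σ hσ⟩
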